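/- Let m and n be natural numbers with m > 2 and n > 1. The following are equivalent: (i) Nil(A_n ∨ X) = ZR(X) for every variety X ⊆ D_m; (ii) n ≥ m − 1. -/

import Mathlib

open FirstOrder

/-! ### Words, identities, and commutative semigroup varieties -/

/-- Semigroup words over the countable alphabet `ℕ`. -/
abbrev SGWord : Type := FreeSemigroup ℕ

/-- A semigroup identity `u = v` is a pair of words. -/
abbrev SGId : Type := SGWord × SGWord

/-- The one-letter word consisting of the letter `n`. -/
def ltr (n : ℕ) : SGWord := FreeSemigroup.of n

/-- `wpow w n` is the word `w^n` (for `n ≥ 1`; by convention `wpow w 0 = w`). -/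
def wpow (w : SGWord) : ℕ → SGWord
  | 0 => w
  | 1 => w
  | n + 2 => wpow w (n + 1) * w

/-- The letter `n` occurs in the word `w`. -/
def OccursIn (n : ℕ) (w : SGWord) : Prop := n = w.head ∨ n ∈ w.tail

/-- A semigroup `S` satisfies the identity `i.1 = i.2` if all evaluations of the two
words in `S` coincide. -/
def SGSatisfies (S : Type) [Semigroup S] (i : SGId) : Prop :=
  ∀ f : ℕ → S, FreeSemigroup.lift f i.1 = FreeSemigroup.lift f i.2

/-- A bundled (nonempty) commutative semigroup. -/
structure ComSG where
  carrier : Type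
  [str : CommSemigroup carrier]
  [instNonempty : Nonempty carrier]

attribute [instance] ComSG.str ComSG.instNonempty

/-- The class of commutative semigroups satisfying every identity in `E`. -/
def modelsOf (E : Set SGId) : Set ComSG := {S | ∀ i ∈ E, SGSatisfies S.carrier i}

/-- The set of identities holding in every member of the class `K`. -/
def theoryOfClass (K : Set ComSG) : Set SGId := {i | ∀ S ∈ K, SGSatisfies S.carrier i}

theorem subset_theoryOfClass_modelsOf (E : Set SGId) : E ⊆ theoryOfClass (modelsOf E) :=
  fun i hi S hS => hS i hi

theorem theoryOfClass_antitone {K K' : Set ComSG} (h : K ⊆ K') :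
    theoryOfClass K' ⊆ theoryOfClass K := fun _ hi S hS => hi S (h hS)

theorem modelsOf_antitone {E E' : Set SGId} (h : E ⊆ E') : modelsOf E' ⊆ modelsOf E :=
  fun _ hS i hi => hS i (h hi)

/-- A variety of commutative semigroups, identified with its (equationally closed)
equational theory.  Varieties are ordered by inclusion of the corresponding classes
of semigroups, i.e. by *reverse* inclusion of theories. -/
structure ComVariety where
  theory : Set SGId
  closed : theoryOfClass (modelsOf theory) = theory

theorem ComVariety.ext' {V W : ComVariety} (h : V.theory = W.theory) : V = W := by
  cases V; cases W; cases h; rfl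

instance : PartialOrder ComVariety where
  le V W := W.theory ⊆ V.theory
  le_refl V := subset_rfl
  le_trans U V W h1 h2 := fun i hi => h1 (h2 hi)
  le_antisymm V W h1 h2 := ComVariety.ext' (subset_antisymm h2 h1)

instance : SupSet ComVariety where
  sSup s :=
    { theory := ⋂ V ∈ s, V.theory
      closed := by
        apply subset_antisymm
        · intro i hi
          refine Set.mem_iInter₂.2 fun V hV => ?_
          have h1 : (⋂ V ∈ s, ComVariety.theory V) ⊆ V.theory := Set.biInter_subset_of_mem hV
          have h2 := theoryOfClass_antitone (modelsOf_antitone h1)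
          rw [V.closed] at h2
          exact h2 hi
        · exact subset_theoryOfClass_modelsOf _ }

/-- The lattice **Com** of all commutative semigroup varieties. -/
instance : CompleteLattice ComVariety :=
  completeLatticeOfSup ComVariety fun s => by
    constructor
    · intro V hV i hi
      exact Set.mem_iInter₂.1 hi V hV
    · intro W hW i hi
      exact Set.mem_iInter₂.2 fun V hV => hW hV hi

/-- The variety of commutative semigroups given by the identity system `E`. -/
def comVar (E : Set SGId) : ComVariety where
  theory := theoryOfClass (modelsOf E)
  closed := by
    apply subset_antisymm
    · exact theoryOfClass_antitone fun S hS i hi => hi S hS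
    · exact subset_theoryOfClass_modelsOf _

/-! ### The first-order language of lattices and definability -/

/-- The first-order language of lattices: two binary function symbols (`true` for the
join `∨` and `false` for the meet `∧`) and nothing else. -/
def latticeLang : Language where
  Functions := fun n => match n with | 2 => Bool | _ => Empty
  Relations := fun _ => Empty

instance latticeLangStructure (L : Type*) [Lattice L] : latticeLang.Structure L where
  funMap {n} f x :=
    match n, f with
    | 2, b => bif b then x 0 ⊔ x 1 else x 0 ⊓ x 1
    | 0, f => f.elim
    | 1, f => f.elim
    | (_ + 3), f => f.elim
  RelMap {n} r _ := r.elim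

/-- A subset `A` of a lattice `L` is definable in `L` if there is a first-order formula
`φ(x)` with one free variable in the language of the lattice operations `∨` and `∧`
such that for every `a ∈ L`, `φ(a)` holds in `L` if and only if `a ∈ A`. -/
def LatDefinable (L : Type*) [Lattice L] (A : Set L) : Prop :=
  ∃ φ : latticeLang.Formula (Fin 1), ∀ a : L, (φ.Realize fun _ => a) ↔ a ∈ A

/-! ### Named varieties -/

/-- The commutativity identity `xy = yx`. -/
def commId : SGId := (ltr 0 * ltr 1, ltr 1 * ltr 0)

/-- The pair of identities abbreviated by the symbolic identity `w = 0`, namely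
`wx = w` and `xw = w`, where `x` is the letter `n` (assumed not to occur in `w`). -/
def zeroId (w : SGWord) (n : ℕ) : Set SGId := {(w * ltr n, w), (ltr n * w, w)}

/-- `A n = var{xⁿy = y, xy = yx}`, the variety of Abelian groups of exponent dividing `n`. -/
def Avar (n : ℕ) : ComVariety := comVar {(wpow (ltr 0) n * ltr 1, ltr 1), commId}

/-- `SL = var{x² = x, xy = yx}`, the variety of semilattices. -/
def SLvar : ComVariety := comVar {(wpow (ltr 0) 2, ltr 0), commId}

/-- `ZM = var{xy = 0}` (within **Com**), the variety of null semigroups. -/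
def ZMvar : ComVariety := comVar ({commId} ∪ zeroId (ltr 0 * ltr 1) 2)

/-- `T = var{x = y}`, the trivial variety. -/
def Tvar : ComVariety := comVar {(ltr 0, ltr 1)}

/-- `COM`, the variety of all commutative semigroups. -/
def COMvar : ComVariety := comVar {commId}

/-- `C m = var{xᵐ = xᵐ⁺¹, xy = yx}` (the variety generated by the cyclic monoid
`⟨a ∣ aᵐ = aᵐ⁺¹⟩`), with the convention `C 0 = T`. -/
def Cvar : ℕ → ComVariety
  | 0 => Tvar
  | m + 1 => comVar {(wpow (ltr 0) (m + 1), wpow (ltr 0) (m + 2)), commId}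

/-- `D m = var{xᵐ = 0, xy = yx}`. -/
def Dvar (m : ℕ) : ComVariety := comVar ({commId} ∪ zeroId (wpow (ltr 0) m) 1)

/-- The word `x₁x₂⋯x_k` (in the letters `0, 1, …, k-1`), for `k ≥ 1`. -/
def chainWord : ℕ → SGWord
  | 0 => ltr 0
  | 1 => ltr 0
  | k + 2 => chainWord (k + 1) * ltr (k + 1)

/-- `N k = var{x² = x₁x₂⋯x_k = 0, xy = yx}`. -/
def Nvar (k : ℕ) : ComVariety :=
  comVar ({commId} ∪ zeroId (wpow (ltr 0) 2) 1 ∪ zeroId (chainWord k) k)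

/-- `N_ω = var{x² = 0, xy = yx}`. -/
def Nomegavar : ComVariety := comVar ({commId} ∪ zeroId (wpow (ltr 0) 2) 1)

/-- `N₃ᶜ = var{xyz = 0, xy = yx}`. -/
def N3cvar : ComVariety := comVar ({commId} ∪ zeroId (ltr 0 * ltr 1 * ltr 2) 3)

/-! ### Semantic notions -/

/-- A semigroup `S` belongs to the variety `V` if it satisfies every identity of `V`. -/
def VMem (S : Type) [Semigroup S] (V : ComVariety) : Prop :=
  ∀ i ∈ V.theory, SGSatisfies S i

/-- `spow a n` is the power `aⁿ` in a semigroup (for `n ≥ 1`; by convention `spow a 0 = a`). -/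
def spow {S : Type} [Semigroup S] (a : S) : ℕ → S
  | 0 => a
  | 1 => a
  | n + 2 => spow a (n + 1) * a

/-- A semigroup is a group. -/
def IsGroupSG (S : Type) [Semigroup S] : Prop :=
  ∃ e : S, (∀ a, e * a = a ∧ a * e = a) ∧ ∀ a, ∃ b, a * b = e ∧ b * a = e

/-- A semigroup is periodic: every element generates a finite cyclic subsemigroup. -/
def IsPeriodicSG (S : Type) [Semigroup S] : Prop :=
  ∀ a : S, ∃ i j : ℕ, 1 ≤ i ∧ i < j ∧ spow a i = spow a j

/-- A semigroup is a nil-semigroup: it has a zero element and every element has a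
power equal to zero. -/
def IsNilSG (S : Type) [Semigroup S] : Prop :=
  ∃ z : S, (∀ a, z * a = z ∧ a * z = z) ∧ ∀ a, ∃ n, 1 ≤ n ∧ spow a n = z

/-- A variety all of whose members are groups. -/
def IsGroupVariety (V : ComVariety) : Prop := ∀ S ∈ modelsOf V.theory, IsGroupSG S.carrier

/-- A variety all of whose members are periodic semigroups. -/
def IsPeriodicVariety (V : ComVariety) : Prop := ∀ S ∈ modelsOf V.theory, IsPeriodicSG S.carrier

/-- A nil-variety: a variety all of whose members are nil-semigroups. -/
def IsNilVariety (V : ComVariety) : Prop := ∀ S ∈ modelsOf V.theory, IsNilSG S.carrier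

/-- A combinatorial variety: all groups in it are trivial. -/
def IsCombinatorial (V : ComVariety) : Prop :=
  ∀ S ∈ modelsOf V.theory, IsGroupSG S.carrier → ∀ a b : S.carrier, a = b

/-- `K` is the variety generated by the semigroup `M` (with explicit semigroup
structure `inst`): the smallest variety containing `M`. -/
def GeneratedBy (M : Type) (inst : Semigroup M) (K : ComVariety) : Prop :=
  IsLeast {W : ComVariety | ∀ i ∈ W.theory, @SGSatisfies M inst i} K

/-- A neutral element of a lattice. -/
def IsNeutralElt {α : Type*} [Lattice α] (x : α) : Prop :=
  ∀ y z, (x ⊔ y) ⊓ (y ⊔ z) ⊓ (z ⊔ x) = (x ⊓ y) ⊔ (y ⊓ z) ⊔ (z ⊓ x)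

/-- A chain variety: a variety whose lattice of subvarieties is a chain. -/
def IsChainVariety (V : ComVariety) : Prop :=
  ∀ W₁ W₂ : ComVariety, W₁ ≤ V → W₂ ≤ V → W₁ ≤ W₂ ∨ W₂ ≤ W₁

/-- A variety is 0-reduced in **Com** if it is given within `COM` by 0-reduced
identities (identities of the form `w = 0`) only. -/
def IsZeroReduced (V : ComVariety) : Prop :=
  ∃ P : Set (SGWord × ℕ), (∀ p ∈ P, ¬ OccursIn p.2 p.1) ∧
    V = comVar (⋃ p ∈ P, zeroId p.1 p.2)

/-- `ZR V`: the least variety 0-reduced in **Com** that contains `V`. -/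
def ZRv (V : ComVariety) : ComVariety := sInf {W : ComVariety | IsZeroReduced W ∧ V ≤ W}

/-! ### Evaluation of words -/

/-- The multiset of letters of a word, counted with multiplicity. -/
def letters (w : SGWord) : Multiset ℕ := w.head ::ₘ (w.tail : Multiset ℕ)

theorem letters_ltr (n : ℕ) : letters (ltr n) = {n} := rfl

theorem letters_mul (u v : SGWord) : letters (u * v) = letters u + letters v := by
  simp [letters, FreeSemigroup.head_mul, FreeSemigroup.tail_mul, ← Multiset.coe_add,
    ← Multiset.cons_coe, Multiset.cons_swap]

theorem mem_letters {n : ℕ} {w : SGWord} : n ∈ letters w ↔ OccursIn n w := by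
  simp [letters, OccursIn]

theorem exists_not_mem_letters (w : SGWord) : ∃ k, k ∉ letters w := by
  obtain ⟨k, hk⟩ := Infinite.exists_notMem_finset (letters w).toFinset
  exact ⟨k, by simpa using hk⟩

theorem lift_ltr {S : Type} [Semigroup S] (f : ℕ → S) (n : ℕ) :
    FreeSemigroup.lift f (ltr n) = f n := FreeSemigroup.lift_of f n

theorem lift_wpow {S : Type} [Semigroup S] (f : ℕ → S) (w : SGWord) (n : ℕ) :
    FreeSemigroup.lift f (wpow w n) = spow (FreeSemigroup.lift f w) n := by
  induction n using wpow.induct with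
  | case1 => rfl
  | case2 => rfl
  | case3 n ih => simp [wpow, spow, ih]

theorem coe_lift {S : Type} [CommSemigroup S] (f : ℕ → S) (w : SGWord) :
    ((FreeSemigroup.lift f w : S) : WithOne S) =
      ((letters w).map fun i => (f i : WithOne S)).prod := by
  induction w using FreeSemigroup.recOnMul with
  | ih1 n =>
    rw [show FreeSemigroup.of n = ltr n from rfl, lift_ltr, letters_ltr]
    simp
  | ih2 u v hu hv =>
    rw [letters_mul, Multiset.map_add, Multiset.prod_add, map_mul, WithOne.coe_mul]
    exact congrArg₂ _ hu hv

theorem coe_spow {S : Type} [CommSemigroup S] (a : S) {n : ℕ} (hn : 1 ≤ n) :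
    ((spow a n : S) : WithOne S) = (a : WithOne S) ^ n := by
  induction n using wpow.induct with
  | case1 => omega
  | case2 => simp [spow]
  | case3 n ih => simp [spow, ih, pow_succ]

theorem lift_congr {S : Type} [CommSemigroup S] {f g : ℕ → S} {w : SGWord}
    (h : ∀ i ∈ letters w, f i = g i) : FreeSemigroup.lift f w = FreeSemigroup.lift g w := by
  apply WithOne.coe_injective
  rw [coe_lift, coe_lift]
  congr 1
  exact Multiset.map_congr rfl fun i hi => by rw [h i hi]

theorem lift_update {S : Type} [CommSemigroup S] (f : ℕ → S) {w : SGWord} {k : ℕ}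
    (hk : k ∉ letters w) (a : S) :
    FreeSemigroup.lift (Function.update f k a) w = FreeSemigroup.lift f w :=
  lift_congr fun _ hi => Function.update_of_ne (ne_of_mem_of_not_mem hi hk) _ _

theorem lift_eq_of_letters_eq {S : Type} [CommSemigroup S] (f : ℕ → S) {u v : SGWord}
    (h : letters u = letters v) : FreeSemigroup.lift f u = FreeSemigroup.lift f v := by
  apply WithOne.coe_injective
  rw [coe_lift, coe_lift, h]

theorem spow_idem {S : Type} [Semigroup S] {z : S} (hz : z * z = z) (n : ℕ) : spow z n = z := by
  induction n using wpow.induct with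
  | case1 => rfl
  | case2 => rfl
  | case3 n ih => simp [spow, ih, hz]

theorem spow_map {S : Type} [Semigroup S] (φ : S → ℕ) (hφ : ∀ a b, φ (a * b) = φ a + φ b)
    (a : S) {n : ℕ} (hn : 1 ≤ n) : φ (spow a n) = n * φ a := by
  induction n using wpow.induct with
  | case1 => omega
  | case2 => simp [spow]
  | case3 n ih => simp [spow, hφ, ih]; ring

/-- Every value of a word with at least `m ≥ 1` occurrences of a letter is absorbing, if all
`m`-th powers are. -/
theorem lift_eq_of_le_count {S : Type} [CommSemigroup S] {z : S} (hz : ∀ a, z * a = z) {m : ℕ}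
    (hm : 1 ≤ m) {x : ℕ} {w : SGWord} (hx : m ≤ (letters w).count x) (f : ℕ → S)
    (hf : spow (f x) m = z) : FreeSemigroup.lift f w = z := by
  obtain ⟨r, hr⟩ := Multiset.le_iff_exists_add.1 (Multiset.le_count_iff_replicate_le.1 hx)
  apply WithOne.coe_injective
  rw [coe_lift, hr, Multiset.map_add, Multiset.prod_add, Multiset.map_replicate,
    Multiset.prod_replicate, ← coe_spow _ hm, hf]
  generalize (r.map fun i => (f i : WithOne S)).prod = q
  induction q using WithOne.recOneCoe with
  | one => rw [mul_one]
  | coe a => rw [← WithOne.coe_mul, hz]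

/-! ### Zero words -/

/-- The symbolic identity `w = 0` holds in `S`. -/
def IsZeroIn (S : Type) [Semigroup S] (w : SGWord) : Prop :=
  ∀ (f : ℕ → S) (a : S), FreeSemigroup.lift f w * a = FreeSemigroup.lift f w

theorem isZeroIn_of_satisfies {S : Type} [CommSemigroup S] {w : SGWord} {k : ℕ}
    (hk : k ∉ letters w) (h : SGSatisfies S (w * ltr k, w)) : IsZeroIn S w := by
  intro f a
  have := h (Function.update f k a)
  simpa [lift_update f hk, lift_ltr] using this

theorem IsZeroIn.satisfies {S : Type} [CommSemigroup S] {w : SGWord} (h : IsZeroIn S w) {k : ℕ}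
    {i : SGId} (hi : i ∈ zeroId w k) : SGSatisfies S i := by
  intro f
  rcases hi with rfl | rfl
  · simp [h f]
  · simp only [map_mul]
    rw [mul_comm, h f]

theorem eq_of_absorbing {S : Type} [CommSemigroup S] {y z : S} (hy : ∀ a, y * a = y)
    (hz : ∀ a, z * a = z) : y = z := by
  rw [← hy z, mul_comm, hz]

/-! ### Varieties and their theories -/

theorem ComVariety.mem_theory_iff (V : ComVariety) {i : SGId} :
    i ∈ V.theory ↔ ∀ S ∈ modelsOf V.theory, SGSatisfies S.carrier i := by
  conv_lhs => rw [← V.closed]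
  rfl

theorem modelsOf_subset_of_le_comVar {X : ComVariety} {E : Set SGId} (h : X ≤ comVar E) :
    modelsOf X.theory ⊆ modelsOf E :=
  modelsOf_antitone ((subset_theoryOfClass_modelsOf E).trans h)

theorem le_comVar {X : ComVariety} {E : Set SGId} (h : modelsOf X.theory ⊆ modelsOf E) :
    X ≤ comVar E := fun _ hi => X.mem_theory_iff.2 fun S hS => hi S (h hS)

theorem mem_theory_sup {V W : ComVariety} {i : SGId} :
    i ∈ (V ⊔ W).theory ↔ i ∈ V.theory ∧ i ∈ W.theory := by
  refine ⟨fun h => ⟨(le_sup_left : V ≤ V ⊔ W) h, (le_sup_right : W ≤ V ⊔ W) h⟩, fun h => ?_⟩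
  have hle : V ⊔ W ≤ sSup {V, W} := sup_le (le_sSup (by simp)) (le_sSup (by simp))
  refine hle (Set.mem_iInter₂.2 fun U hU => ?_)
  rcases hU with rfl | rfl
  exacts [h.1, h.2]

/-- The variety generated by a commutative semigroup. -/
def varOf (S : ComSG) : ComVariety where
  theory := theoryOfClass {S}
  closed := by
    refine subset_antisymm (theoryOfClass_antitone ?_) (subset_theoryOfClass_modelsOf _)
    rintro _ rfl i hi
    exact hi _ rfl

theorem mem_modelsOf_varOf (S : ComSG) : S ∈ modelsOf (varOf S).theory := fun _ hi => hi S rfl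

theorem varOf_le_comVar {S : ComSG} {E : Set SGId} (h : S ∈ modelsOf E) :
    varOf S ≤ comVar E := by
  rintro i hi _ rfl
  exact hi _ h

theorem isZeroIn_ZRv {X : ComVariety} {w : SGWord}
    (h : ∀ S ∈ modelsOf X.theory, IsZeroIn S.carrier w) :
    ∀ S ∈ modelsOf (ZRv X).theory, IsZeroIn S.carrier w := by
  intro S hS
  obtain ⟨k, hk⟩ := exists_not_mem_letters w
  have hle : ZRv X ≤ comVar (zeroId w k) := by
    refine sInf_le ⟨⟨{(w, k)}, ?_, by simp⟩, ?_⟩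
    · rintro _ rfl
      exact fun h => hk (mem_letters.2 h)
    · exact le_comVar fun S hS i hi => (h S hS).satisfies hi
  exact isZeroIn_of_satisfies hk (modelsOf_subset_of_le_comVar hle hS _ (Or.inl rfl))

theorem isZeroIn_of_le_Dvar {X : ComVariety} {m : ℕ} (hX : X ≤ Dvar m) :
    ∀ S ∈ modelsOf X.theory, IsZeroIn S.carrier (wpow (ltr 0) m) := by
  intro S hS
  refine isZeroIn_of_satisfies (k := 1) ?_
    (modelsOf_subset_of_le_comVar hX hS _ (Or.inr (Or.inl rfl)))
  suffices ∀ n, letters (wpow (ltr 0) n) ⊆ {0} from fun h => by simpa using this m h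
  intro n
  induction n using wpow.induct with
  | case1 => simp [wpow, letters_ltr]
  | case2 => simp [wpow, letters_ltr]
  | case3 n ih =>
    intro i hi
    rw [wpow, letters_mul, Multiset.mem_add] at hi
    exact hi.elim (fun h => ih h) fun h => by simpa [letters_ltr] using h

theorem IsZeroIn.spow_mul {S : Type} [CommSemigroup S] {m : ℕ}
    (h : IsZeroIn S (wpow (ltr 0) m)) (a b : S) : spow a m * b = spow a m := by
  simpa [lift_wpow, lift_ltr] using h (fun _ => a) b

theorem isNilVariety_ZRv {X : ComVariety} {m : ℕ} (hm : 1 ≤ m) (hX : X ≤ Dvar m) :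
    IsNilVariety (ZRv X) := by
  intro S hS
  have h := (isZeroIn_ZRv (isZeroIn_of_le_Dvar hX) S hS).spow_mul
  obtain ⟨a⟩ := S.instNonempty
  exact ⟨spow a m, fun b => ⟨h a b, by rw [mul_comm, h]⟩,
    fun b => ⟨m, hm, eq_of_absorbing (h b) (h a)⟩⟩

theorem Avar_spow_mul {S : ComSG} {n : ℕ} (hS : S ∈ modelsOf (Avar n).theory) (a b : S.carrier) :
    spow a n * b = b := by
  have := modelsOf_subset_of_le_comVar le_rfl hS _ (Or.inl rfl) fun i => if i = 0 then a else b
  simpa [lift_wpow, lift_ltr] using this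

/-- A nil-subvariety of `A n ∨ X` lies in `ZR X`. -/
theorem le_ZRv_of_isNilVariety {X W : ComVariety} {n : ℕ}
    (hW : W ≤ Avar n ⊔ X) (hnil : IsNilVariety W) : W ≤ ZRv X := by
  refine le_sInf ?_
  rintro _ ⟨⟨P, hP, rfl⟩, hX⟩
  refine le_comVar fun S hS i hi => ?_
  obtain ⟨⟨w, k⟩, hp, hi⟩ := Set.mem_iUnion₂.1 hi
  have hk : k ∉ letters w := fun h => hP _ hp (mem_letters.1 h)
  have hzero : ∀ T ∈ modelsOf X.theory, IsZeroIn T.carrier w := fun T hT =>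
    isZeroIn_of_satisfies hk (modelsOf_subset_of_le_comVar hX hT _
      (Set.mem_iUnion₂.2 ⟨_, hp, Or.inl rfl⟩))
  have hid : (w * wpow (ltr k) n, w) ∈ W.theory := by
    refine hW (mem_theory_sup.2 ⟨?_, ?_⟩)
    · refine (Avar n).mem_theory_iff.2 fun T hT f => ?_
      rw [map_mul, lift_wpow, mul_comm, Avar_spow_mul hT]
    · refine X.mem_theory_iff.2 fun T hT f => ?_
      rw [map_mul, hzero T hT]
  obtain ⟨z, hz, -⟩ := hnil S hS
  refine IsZeroIn.satisfies (fun f a => ?_) hi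
  have h := hS _ hid (Function.update f k z)
  simp only [map_mul, lift_wpow, lift_ltr, lift_update f hk, Function.update_self,
    spow_idem (hz z).1, (hz _).2] at h
  rw [← h, (hz a).1]

/-! ### The case `m - 1 ≤ n` -/

theorem count_modEq_of_mem_Avar {n : ℕ} {i : SGId} (hn : 1 ≤ n) (hi : i ∈ (Avar n).theory)
    (x : ℕ) : (letters i.1).count x ≡ (letters i.2).count x [MOD n] := by
  let G : ComSG := ⟨Multiplicative (ZMod n)⟩
  have hG : G ∈ modelsOf {(wpow (ltr 0) n * ltr 1, ltr 1), commId} := by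
    rintro _ (rfl | rfl) f
    · have h : spow (f 0) n = (1 : Multiplicative (ZMod n)) := by
        have key : ∀ (a : Multiplicative (ZMod n)) (k : ℕ), 1 ≤ k → spow a k = a ^ k := by
          intro a k hk
          induction k using wpow.induct with
          | case1 => omega
          | case2 => simp [spow]
          | case3 k ih => simp [spow, ih, pow_succ]
        rw [key _ n hn]
        apply Multiplicative.toAdd.injective
        simp
      simp only [map_mul, lift_wpow, lift_ltr]
      rw [h]
      exact one_mul (M := Multiplicative (ZMod n)) _
    · simp only [commId, map_mul]
      exact mul_comm _ _
  have hval : ∀ w : SGWord, FreeSemigroup.lift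
      (fun j => Multiplicative.ofAdd (if x = j then (1 : ZMod n) else 0)) w =
        Multiplicative.ofAdd (((letters w).count x : ℕ) : ZMod n) := by
    intro w
    induction w using FreeSemigroup.recOnMul with
    | ih1 j =>
      rw [show FreeSemigroup.of j = ltr j from rfl, lift_ltr, letters_ltr, Multiset.count_singleton]
      split_ifs <;> simp
    | ih2 u v hu hv =>
      rw [letters_mul, Multiset.count_add, map_mul, Nat.cast_add, ofAdd_add]
      exact congrArg₂ _ hu hv
  have h := hi G hG (fun j => Multiplicative.ofAdd (if x = j then (1 : ZMod n) else 0) :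
    ℕ → Multiplicative (ZMod n))
  have h' := (hval i.1).symm.trans (h.trans (hval i.2))
  exact (ZMod.natCast_eq_natCast_iff _ _ _).1 (Multiplicative.ofAdd.injective h')

theorem isZeroIn_of_count_lt {X : ComVariety} {m n : ℕ} (hm : 1 ≤ m) (hn : 1 ≤ n)
    (hmn : m ≤ n + 1) (hX : X ≤ Dvar m) {u v : SGWord} (hA : (u, v) ∈ (Avar n).theory)
    (hXuv : (u, v) ∈ X.theory) {x : ℕ} (hx : (letters v).count x < (letters u).count x) :
    ∀ S ∈ modelsOf X.theory, IsZeroIn S.carrier u ∧ IsZeroIn S.carrier v := by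
  intro S hS
  have hpow := (isZeroIn_of_le_Dvar hX S hS).spow_mul
  obtain ⟨s⟩ := S.instNonempty
  obtain ⟨z, hz⟩ : ∃ z, z = spow s m := ⟨_, rfl⟩
  have habs : ∀ a, z * a = z := fun a => by rw [hz, hpow]
  have heq : ∀ a, spow a m = z := fun a => eq_of_absorbing (hpow a) habs
  have huv : ∀ f : ℕ → S.carrier, FreeSemigroup.lift f u = FreeSemigroup.lift f v := hS _ hXuv
  have hle : (letters v).count x + n ≤ (letters u).count x := by
    have := (count_modEq_of_mem_Avar hn hA x).symm
    have := Nat.le_of_dvd (Nat.sub_pos_of_lt hx) ((Nat.modEq_iff_dvd' hx.le).1 this)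
    omega
  have hu : ∀ f : ℕ → S.carrier, FreeSemigroup.lift f u = z := by
    intro f
    by_cases hv : x ∈ letters v
    · have := Multiset.one_le_count_iff_mem.2 hv
      exact lift_eq_of_le_count habs hm (x := x) (by omega) f (heq _)
    · rw [huv, ← lift_update f hv z, ← huv]
      exact lift_eq_of_le_count habs le_rfl (x := x) (by omega) _ (by simp [spow])
  exact ⟨fun f a => by rw [hu, habs], fun f a => by rw [← huv, hu, habs]⟩

theorem ZRv_le_sup {X : ComVariety} {m n : ℕ} (hm : 1 ≤ m) (hn : 1 ≤ n) (hmn : m ≤ n + 1)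
    (hX : X ≤ Dvar m) : ZRv X ≤ Avar n ⊔ X := by
  rintro ⟨u, v⟩ hi
  obtain ⟨hA, hXuv⟩ := mem_theory_sup.1 hi
  by_cases huv : letters u = letters v
  · exact (ZRv X).mem_theory_iff.2 fun S _ f => lift_eq_of_letters_eq f huv
  have hzero : ∀ S ∈ modelsOf X.theory, IsZeroIn S.carrier u ∧ IsZeroIn S.carrier v := by
    obtain ⟨x, hx⟩ : ∃ x, (letters u).count x ≠ (letters v).count x := by
      by_contra! h
      exact huv (Multiset.ext.2 h)
    rcases hx.lt_or_gt with hx | hx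
    · have hsymm : ∀ V : ComVariety, (u, v) ∈ V.theory → (v, u) ∈ V.theory := fun V h =>
        V.mem_theory_iff.2 fun S hS f => (hS _ h f).symm
      exact fun S hS =>
        (isZeroIn_of_count_lt hm hn hmn hX (hsymm _ hA) (hsymm _ hXuv) hx S hS).symm
    · exact isZeroIn_of_count_lt hm hn hmn hX hA hXuv hx
  exact (ZRv X).mem_theory_iff.2 fun S hS f => eq_of_absorbing
    (isZeroIn_ZRv (fun T hT => (hzero T hT).1) S hS f)
    (isZeroIn_ZRv (fun T hT => (hzero T hT).2) S hS f)

/-! ### The case `n < m - 1` -/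

/-- The free commutative semigroup on two generators, as pairs of exponents. -/
def Exps : Type := {p : ℕ × ℕ // 0 < p.1 + p.2}

instance : CommSemigroup Exps where
  mul p q := ⟨p.1 + q.1, by have := p.2; simp only [Prod.fst_add, Prod.snd_add]; omega⟩
  mul_assoc p q r := Subtype.ext (add_assoc p.1 q.1 r.1)
  mul_comm p q := Subtype.ext (add_comm p.1 q.1)

theorem Exps.fst_mul (p q : Exps) : (p * q).1.1 = p.1.1 + q.1.1 := rfl

theorem Exps.snd_mul (p q : Exps) : (p * q).1.2 = p.1.2 + q.1.2 := rfl

/-- The monomials of degree above `n + 2`, together with the two pure powers of degree `n + 2`. -/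
def Exps.Vanishes (n : ℕ) (p : Exps) : Prop :=
  n + 2 < p.1.1 + p.1.2 ∨ (n + 2 = p.1.1 + p.1.2 ∧ (p.1.1 = 0 ∨ p.1.2 = 0))

theorem Exps.Vanishes.mul {n : ℕ} {p : Exps} (h : p.Vanishes n) (q : Exps) :
    (p * q).Vanishes n := by
  have := q.2
  simp only [Exps.Vanishes, Exps.fst_mul, Exps.snd_mul] at *
  omega

theorem Exps.vanishes_mul_of_degree {n : ℕ} {p : Exps} (h : n + 2 ≤ p.1.1 + p.1.2) (q : Exps) :
    (p * q).Vanishes n := by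
  have := q.2
  simp only [Exps.Vanishes, Exps.fst_mul, Exps.snd_mul] at *
  omega

/-- Identify all vanishing monomials and, if `glue` holds, also all the remaining monomials of
degree `n + 2`. -/
def monoCon (n : ℕ) (glue : Prop) : Con Exps where
  r p q := p = q ∨ (p.Vanishes n ∧ q.Vanishes n) ∨
    (glue ∧ (p.1.1 + p.1.2 = n + 2 ∧ ¬ p.Vanishes n) ∧ (q.1.1 + q.1.2 = n + 2 ∧ ¬ q.Vanishes n))
  iseqv :=
    { refl := fun _ => Or.inl rfl
      symm := by
        rintro p q (h | h | h)
        exacts [Or.inl h.symm, Or.inr (Or.inl h.symm), Or.inr (Or.inr ⟨h.1, h.2.symm⟩)]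
      trans := by
        rintro p q r (rfl | h | h) (rfl | h' | h') <;> tauto }
  mul' := by
    have key : ∀ p q r : Exps, (p = q ∨ (p.Vanishes n ∧ q.Vanishes n) ∨
        (glue ∧ (p.1.1 + p.1.2 = n + 2 ∧ ¬ p.Vanishes n) ∧
          (q.1.1 + q.1.2 = n + 2 ∧ ¬ q.Vanishes n))) →
        p * r = q * r ∨ ((p * r).Vanishes n ∧ (q * r).Vanishes n) := by
      rintro p q r (rfl | h | h)
      · exact Or.inl rfl
      · exact Or.inr ⟨h.1.mul r, h.2.mul r⟩
      · exact Or.inr ⟨Exps.vanishes_mul_of_degree h.2.1.1.ge r,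
          Exps.vanishes_mul_of_degree h.2.2.1.ge r⟩
    intro p q r s hpq hrs
    have h₁ := key p q r hpq
    have h₂ := key r s q hrs
    rw [mul_comm r q, mul_comm s q] at h₂
    rcases h₁ with h₁ | h₁
    · rw [h₁]
      tauto
    · rcases h₂ with h₂ | h₂
      · rw [← h₂]
        tauto
      · tauto

theorem monoCon_of_vanishes {n : ℕ} {glue : Prop} {p q : Exps} (hp : p.Vanishes n)
    (hq : q.Vanishes n) : (p : (monoCon n glue).Quotient) = q :=
  (Con.eq _).2 (Or.inr (Or.inl ⟨hp, hq⟩))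

theorem Exps.Vanishes.of_eq {n : ℕ} {glue : Prop} {p q : Exps} (hp : p.Vanishes n)
    (h : (p : (monoCon n glue).Quotient) = q) : q.Vanishes n := by
  rcases (Con.eq _).1 h with rfl | h | h
  · exact hp
  · exact h.2
  · exact absurd hp h.2.1.2

/-- The quotient of the free commutative semigroup by `monoCon`. -/
def monoSG (n : ℕ) (glue : Prop) : ComSG where
  carrier := (monoCon n glue).Quotient
  str := inferInstance
  instNonempty := ⟨Con.toQuotient (c := monoCon n glue) (⟨(1, 0), by simp⟩ : Exps)⟩

theorem lift_coe {M : Type} [CommSemigroup M] (c : Con M) (g : ℕ → M) (w : SGWord) :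
    FreeSemigroup.lift (fun i => (g i : c.Quotient)) w =
      ((FreeSemigroup.lift g w : M) : c.Quotient) := by
  induction w using FreeSemigroup.recOnMul with
  | ih1 j => simp
  | ih2 u v hu hv => rw [map_mul, map_mul, Con.coe_mul, hu, hv]

theorem exists_lift_coe {M : Type} [CommSemigroup M] (c : Con M) (f : ℕ → c.Quotient) :
    ∃ g : ℕ → M, f = fun i => (g i : c.Quotient) := by
  choose g hg using fun i => Quotient.exists_rep (f i)
  exact ⟨g, funext fun i => (hg i).symm⟩

theorem monoSG_satisfies_iff {n : ℕ} {glue : Prop} {i : SGId} :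
    SGSatisfies (monoSG n glue).carrier i ↔ ∀ g : ℕ → Exps,
      ((FreeSemigroup.lift g i.1 : Exps) : (monoCon n glue).Quotient) =
        (FreeSemigroup.lift g i.2 : Exps) := by
  constructor
  · intro h g
    rw [← lift_coe, ← lift_coe]
    exact h fun i => (g i : (monoCon n glue).Quotient)
  · intro h f
    obtain ⟨g, rfl⟩ := exists_lift_coe (monoCon n glue) f
    exact (lift_coe _ g i.1).trans ((h g).trans (lift_coe _ g i.2).symm)

/-- If `w = 0` holds in `monoSG n glue`, then all values of `w` vanish. -/
theorem vanishes_of_monoSG_satisfies {n : ℕ} {glue : Prop} {w : SGWord} {k : ℕ}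
    (hk : k ∉ letters w) (h : SGSatisfies (monoSG n glue).carrier (w * ltr k, w))
    (g : ℕ → Exps) : (FreeSemigroup.lift g w).Vanishes n := by
  obtain ⟨q, hq⟩ : ∃ q : Exps, n + 2 ≤ q.1.1 + q.1.2 := ⟨⟨(n + 2, 0), by simp⟩, by simp⟩
  have := monoSG_satisfies_iff.1 h (Function.update g k q)
  simp only [map_mul, lift_ltr, lift_update g hk, Function.update_self] at this
  refine Exps.Vanishes.of_eq ?_ this
  rw [mul_comm]
  exact Exps.vanishes_mul_of_degree hq _

theorem monoSG_satisfies_zeroId {n : ℕ} {glue : Prop} {w : SGWord}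
    (h : ∀ g : ℕ → Exps, (FreeSemigroup.lift g w).Vanishes n) {k : ℕ} {i : SGId}
    (hi : i ∈ zeroId w k) : SGSatisfies (monoSG n glue).carrier i := by
  refine monoSG_satisfies_iff.2 fun g => ?_
  rcases hi with rfl | rfl
  · rw [map_mul]
    exact monoCon_of_vanishes ((h g).mul _) (h g)
  · rw [map_mul, mul_comm]
    exact monoCon_of_vanishes ((h g).mul _) (h g)

theorem varOf_monoSG_le_Dvar {m n : ℕ} (hmn : n + 2 ≤ m) (glue : Prop) :
    varOf (monoSG n glue) ≤ Dvar m := by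
  refine varOf_le_comVar ?_
  rintro i (rfl | hi)
  · intro f
    simp only [commId, map_mul]
    exact mul_comm _ _
  · refine monoSG_satisfies_zeroId (fun g => ?_) hi
    rw [lift_wpow, lift_ltr]
    have h₁ := spow_map (fun p : Exps => p.1.1) Exps.fst_mul (g 0) (n := m) (by omega)
    have h₂ := spow_map (fun p : Exps => p.1.2) Exps.snd_mul (g 0) (n := m) (by omega)
    simp only [Exps.Vanishes, h₁, h₂]
    have hpos := (g 0).2
    generalize (g 0).1.1 = a at *
    generalize (g 0).1.2 = b at *
    rcases Nat.lt_or_ge (a + b) 2 with h | h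
    · obtain ⟨rfl, rfl⟩ | ⟨rfl, rfl⟩ : (a = 0 ∧ b = 1) ∨ (a = 1 ∧ b = 0) := by omega
      all_goals omega
    · left
      nlinarith

theorem varOf_monoSG_le_ZRv (n : ℕ) (glue glue' : Prop) :
    varOf (monoSG n glue) ≤ ZRv (varOf (monoSG n glue')) := by
  refine le_sInf ?_
  rintro _ ⟨⟨P, hP, rfl⟩, hX⟩
  refine varOf_le_comVar fun i hi => ?_
  obtain ⟨⟨w, k⟩, hp, hi⟩ := Set.mem_iUnion₂.1 hi
  refine monoSG_satisfies_zeroId (vanishes_of_monoSG_satisfies (glue := glue')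
    (fun h => hP _ hp (mem_letters.1 h)) ?_) hi
  exact modelsOf_subset_of_le_comVar hX (mem_modelsOf_varOf _) _
    (Set.mem_iUnion₂.2 ⟨_, hp, Or.inl rfl⟩)

/-- The identity `xⁿ⁺¹y = xyⁿ⁺¹`. -/
def swapId (n : ℕ) : SGId := (wpow (ltr 0) (n + 1) * ltr 1, wpow (ltr 1) (n + 1) * ltr 0)

theorem swapId_mem_Avar {n : ℕ} (hn : 1 ≤ n) : swapId n ∈ (Avar n).theory := by
  refine (Avar n).mem_theory_iff.2 fun S hS f => ?_
  obtain ⟨n, rfl⟩ := Nat.exists_eq_add_of_le' hn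
  simp only [swapId, map_mul, lift_wpow, lift_ltr, spow]
  rw [Avar_spow_mul hS, Avar_spow_mul hS, mul_comm]

theorem Exps.fst_spow_mul (n : ℕ) (p q : Exps) :
    (spow p (n + 1) * q).1.1 = (n + 1) * p.1.1 + q.1.1 := by
  rw [Exps.fst_mul, spow_map (fun p : Exps => p.1.1) Exps.fst_mul p (by omega)]

theorem Exps.snd_spow_mul (n : ℕ) (p q : Exps) :
    (spow p (n + 1) * q).1.2 = (n + 1) * p.1.2 + q.1.2 := by
  rw [Exps.snd_mul, spow_map (fun p : Exps => p.1.2) Exps.snd_mul p (by omega)]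

theorem swapId_mem_glued (n : ℕ) : swapId n ∈ (varOf (monoSG n True)).theory := by
  rintro _ rfl
  refine monoSG_satisfies_iff.2 fun g => ?_
  simp only [swapId, map_mul, lift_wpow, lift_ltr]
  refine (Con.eq _).2 (Or.inr ?_)
  simp only [Exps.Vanishes, Exps.fst_spow_mul, Exps.snd_spow_mul, true_and]
  have h₀ := (g 0).2
  have h₁ := (g 1).2
  generalize (g 0).1.1 = a at *
  generalize (g 0).1.2 = b at *
  generalize (g 1).1.1 = c at *
  generalize (g 1).1.2 = d at *
  by_cases h : a + b = 1 ∧ c + d = 1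
  · obtain ⟨rfl, rfl⟩ | ⟨rfl, rfl⟩ : (a = 0 ∧ b = 1) ∨ (a = 1 ∧ b = 0) := by omega
    all_goals
      obtain ⟨rfl, rfl⟩ | ⟨rfl, rfl⟩ : (c = 0 ∧ d = 1) ∨ (c = 1 ∧ d = 0) := by omega
      all_goals omega
  · have h' : 3 ≤ (a + b) + (c + d) := by omega
    refine Or.inl ⟨Or.inl ?_, Or.inl ?_⟩
    · nlinarith [Nat.mul_le_mul_left n h₀]
    · nlinarith [Nat.mul_le_mul_left n h₁]

theorem swapId_not_mem_unglued {n : ℕ} (hn : 1 ≤ n) :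
    swapId n ∉ (varOf (monoSG n False)).theory := by
  intro h
  have := monoSG_satisfies_iff.1 (h _ rfl)
    fun i => if i = 0 then ⟨(1, 0), by simp⟩ else ⟨(0, 1), by simp⟩
  simp only [swapId, map_mul, lift_wpow, lift_ltr] at this
  rcases (Con.eq _).1 this with h | h | h
  · have := congrArg (fun p : Exps => p.1.1) h
    simp only [Exps.fst_spow_mul] at this
    simp at this
    omega
  · have := h.1
    simp only [Exps.Vanishes, Exps.fst_spow_mul, Exps.snd_spow_mul] at this
    simp at this
  · exact h.1

/-- **Lemma.** Let `m` and `n` be natural numbers with `m > 2` and `n > 1`.  The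
following are equivalent: (i) for every variety `X ⊆ D m`, the variety `ZR X` is the
greatest nil-subvariety of `A n ∨ X` (i.e. `Nil(A n ∨ X) = ZR X`); (ii) `n ≥ m - 1`. -/
theorem nil_part_eq_ZR_iff (m n : ℕ) (hm : 2 < m) (hn : 1 < n) :
    (∀ X : ComVariety, X ≤ Dvar m →
        IsGreatest {W : ComVariety | W ≤ Avar n ⊔ X ∧ IsNilVariety W} (ZRv X)) ↔
      m - 1 ≤ n := by
  constructor
  · intro h
    by_contra hmn
    have hle := (h _ (varOf_monoSG_le_Dvar (show n + 2 ≤ m by omega) True)).1.1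
    exact swapId_not_mem_unglued hn.le (varOf_monoSG_le_ZRv n False True
      (hle (mem_theory_sup.2 ⟨swapId_mem_Avar hn.le, swapId_mem_glued n⟩)))
  · intro hmn X hX
    exact ⟨⟨ZRv_le_sup (by omega) hn.le (by omega) hX, isNilVariety_ZRv (by omega) hX⟩,
      fun W hW => le_ZRv_of_isNilVariety hW.1 hW.2⟩
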